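/- (Jörgens–Calabi–Pogorelov theorem, n = 2) Let u : ℝ² → ℝ be a smooth convex function satisfying det(∂²u/∂xⁱ∂xʲ) = 1 everywhere. Then u is a quadratic polynomial. -/

import Mathlib

open Matrix

/-- The Hessian matrix of second partial derivatives of `u` at `x`. -/
noncomputable def Hess {n : ℕ} (u : (Fin n → ℝ) → ℝ) (x : Fin n → ℝ) :
    Matrix (Fin n) (Fin n) ℝ :=
  fun i j => iteratedFDeriv ℝ 2 u x ![Pi.single i 1, Pi.single j 1]

section Convex

variable {E : Type*} [NormedAddCommGroup E] [NormedSpace ℝ E] {u : E → ℝ}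

/-- A differentiable convex function lies above its tangent planes. -/
theorem ConvexOn.add_fderiv_le (hc : ConvexOn ℝ Set.univ u) (hd : Differentiable ℝ u) (z w : E) :
    u z + fderiv ℝ u z (w - z) ≤ u w := by
  have hline : ConvexOn ℝ Set.univ (fun t : ℝ => u (AffineMap.lineMap z w t)) :=
    hc.comp_affineMap (AffineMap.lineMap z w : ℝ →ᵃ[ℝ] E)
  have hder : HasDerivAt (fun t : ℝ => u (AffineMap.lineMap z w t)) (fderiv ℝ u z (w - z)) 0 := by
    have h := (hd (AffineMap.lineMap z w (0 : ℝ))).hasFDerivAt.comp_hasDerivAt (0 : ℝ)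
      (AffineMap.hasDerivAt_lineMap (a := z) (b := w))
    rwa [AffineMap.lineMap_apply_zero] at h
  have h := hline.le_slope_of_hasDerivAt (Set.mem_univ _) (Set.mem_univ _) zero_lt_one hder
  simp [slope_def_field] at h
  simp
  linarith

/-- The derivative of a differentiable convex function is monotone. -/
theorem ConvexOn.fderiv_sub_fderiv_nonneg (hc : ConvexOn ℝ Set.univ u) (hd : Differentiable ℝ u)
    (z w : E) : 0 ≤ (fderiv ℝ u z - fderiv ℝ u w) (z - w) := by
  have h₁ := hc.add_fderiv_le hd z w
  have h₂ := hc.add_fderiv_le hd w z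
  rw [← neg_sub z w, map_neg] at h₁
  simp only [_root_.sub_apply]
  linarith

/-- The second derivative of a convex function is positive semidefinite. -/
theorem ConvexOn.fderiv_fderiv_nonneg (hc : ConvexOn ℝ Set.univ u) (hd : Differentiable ℝ u)
    (hd₂ : Differentiable ℝ (fderiv ℝ u)) (z v : E) :
    0 ≤ fderiv ℝ (fderiv ℝ u) z v v := by
  have hmono : Monotone (fun t : ℝ => fderiv ℝ u (z + t • v) v) := by
    intro s t hst
    rcases hst.eq_or_lt with rfl | hst
    · exact le_rfl
    have h := hc.fderiv_sub_fderiv_nonneg hd (z + t • v) (z + s • v)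
    rw [add_sub_add_left_eq_sub, ← sub_smul, map_smul, smul_eq_mul] at h
    have h' := nonneg_of_mul_nonneg_right h (sub_pos.2 hst)
    simpa using h'
  have hder : HasDerivAt (fun t : ℝ => fderiv ℝ u (z + t • v) v)
      (fderiv ℝ (fderiv ℝ u) z v v) 0 := by
    have hl : HasDerivAt (fun t : ℝ => z + t • v) v 0 := by
      simpa using ((hasDerivAt_id (0 : ℝ)).smul_const v).const_add z
    have h := (hd₂ (z + (0 : ℝ) • v)).hasFDerivAt.comp_hasDerivAt (0 : ℝ) hl
    simpa using h.clm_apply (hasDerivAt_const (0 : ℝ) v)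
  exact hder.deriv ▸ hmono.deriv_nonneg

/-- A function with constant second derivative is a quadratic polynomial. -/
theorem eq_quadratic_of_fderiv_fderiv_const (hd : Differentiable ℝ u)
    (hd₂ : Differentiable ℝ (fderiv ℝ u)) {B : E →L[ℝ] E →L[ℝ] ℝ}
    (hsymm : ∀ v w, B v w = B w v) (hB : ∀ z, fderiv ℝ (fderiv ℝ u) z = B) (z : E) :
    u z = (1 / 2) * B z z + fderiv ℝ u 0 z + u 0 := by
  have hgrad : ∀ z, fderiv ℝ u z = B z + fderiv ℝ u 0 := by
    intro z
    have h := is_const_of_fderiv_eq_zero (𝕜 := ℝ) (f := fun z => fderiv ℝ u z - B z)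
      (hd₂.sub B.differentiable) (fun x => by
        rw [fderiv_fun_sub (hd₂ x) B.differentiableAt, hB, B.fderiv, sub_self]) z 0
    simp only [map_zero, sub_zero] at h
    rw [← h]; abel
  have hder : ∀ x, HasFDerivAt (fun z => u z - ((1 / 2) * B z z + fderiv ℝ u 0 z))
      (0 : E →L[ℝ] ℝ) x := by
    intro x
    have hq : HasFDerivAt (fun z => B z z) _ x := B.hasFDerivAt.clm_apply (hasFDerivAt_id x)
    have h := (hd x).hasFDerivAt.sub ((hq.const_mul (1 / 2)).add (fderiv ℝ u 0).hasFDerivAt)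
    refine h.congr_fderiv ?_
    ext v
    simp [hgrad x, hsymm v x]
    ring
  have h := is_const_of_fderiv_eq_zero (𝕜 := ℝ) (fun x => (hder x).differentiableAt)
    (fun x => (hder x).fderiv) z 0
  simp at h
  linarith

end Convex

theorem HasFDerivAt.ofReal_add_ofReal_mul_I {E : Type*} [NormedAddCommGroup E] [NormedSpace ℝ E]
    {a b : E → ℝ} {a' b' : E →L[ℝ] ℝ} {z : E} (ha : HasFDerivAt a a' z) (hb : HasFDerivAt b b' z) :
    HasFDerivAt (fun z => (a z : ℂ) + (b z : ℂ) * Complex.I)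
      (Complex.ofRealCLM ∘L a' + Complex.I • (Complex.ofRealCLM ∘L b')) z := by
  have ha' := Complex.ofRealCLM.hasFDerivAt.comp z ha
  have hb' := (Complex.ofRealCLM.hasFDerivAt.comp z hb).const_smul Complex.I
  refine (ha'.add hb').congr_of_eventuallyEq (.of_forall fun w => ?_)
  simp [mul_comm]

/-- Complex derivative of `W ∘ g`, where `g` is a continuous right inverse of an expanding map `L`
and `W` is conformally related to `L` to first order at `g ζ`. -/
theorem hasDerivAt_comp_rightInverse {E : Type*} [NormedAddCommGroup E] [NormedSpace ℝ E]
    {L W : E → ℂ} {g : ℂ → E} {c : ℂ} {ζ : ℂ} (hL : AntilipschitzWith 1 L)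
    (hg : Function.RightInverse g L)
    (h : HasFDerivAt (fun z => W z - c * L z) (0 : E →L[ℝ] ℂ) (g ζ)) :
    HasDerivAt (fun ξ => W (g ξ)) c ζ := by
  have hlip := hL.to_rightInverse hg
  have h₁ := (hasFDerivAt_iff_isLittleO.1 h).comp_tendsto (hlip.continuous.tendsto ζ)
  rw [hasDerivAt_iff_isLittleO]
  have h₂ : (fun ξ => g ξ - g ζ) =O[nhds ζ] fun ξ => ξ - ζ :=
    Asymptotics.IsBigO.of_bound 1 (.of_forall fun ξ => by
      simpa [dist_eq_norm] using hlip.dist_le_mul ξ ζ)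
  refine (h₁.trans_isBigO h₂).congr_left fun ξ => ?_
  simp [hg _]
  ring

/-- The Lewy transformation `(x, y) ↦ (x + uₓ) + i (y + u_y)`. -/
noncomputable def lewyMap (u : (Fin 2 → ℝ) → ℝ) (z : Fin 2 → ℝ) : ℂ :=
  ((z 0 + fderiv ℝ u z (Pi.single 0 1) : ℝ) : ℂ) +
    ((z 1 + fderiv ℝ u z (Pi.single 1 1) : ℝ) : ℂ) * Complex.I

/-- The companion `(x, y) ↦ (x - uₓ) - i (y - u_y)` of the Lewy transformation. -/
noncomputable def lewyConj (u : (Fin 2 → ℝ) → ℝ) (z : Fin 2 → ℝ) : ℂ :=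
  ((z 0 - fderiv ℝ u z (Pi.single 0 1) : ℝ) : ℂ) +
    ((-(z 1 - fderiv ℝ u z (Pi.single 1 1)) : ℝ) : ℂ) * Complex.I

theorem eq_smul_single_add_smul_single (v : Fin 2 → ℝ) :
    v = v 0 • Pi.single 0 1 + v 1 • Pi.single 1 1 := by
  ext i; fin_cases i <;> simp

theorem ContinuousLinearMap.apply_fin_two {F : Type*} [NormedAddCommGroup F] [NormedSpace ℝ F]
    (l : (Fin 2 → ℝ) →L[ℝ] F) (v : Fin 2 → ℝ) :
    l v = v 0 • l (Pi.single 0 1) + v 1 • l (Pi.single 1 1) := by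
  conv_lhs => rw [eq_smul_single_add_smul_single v]
  simp only [map_add, map_smul]

theorem ContinuousLinearMap.ext_fin_two {F : Type*} [NormedAddCommGroup F] [NormedSpace ℝ F]
    {l l' : (Fin 2 → ℝ) →L[ℝ] F} (h₀ : l (Pi.single 0 1) = l' (Pi.single 0 1))
    (h₁ : l (Pi.single 1 1) = l' (Pi.single 1 1)) : l = l' := by
  ext1 v
  rw [l.apply_fin_two, l'.apply_fin_two, h₀, h₁]

theorem norm_sq_le_sq_add_sq (v : Fin 2 → ℝ) : ‖v‖ ^ 2 ≤ v 0 ^ 2 + v 1 ^ 2 := by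
  have h : ‖v‖ ≤ √(v 0 ^ 2 + v 1 ^ 2) := by
    refine (pi_norm_le_iff_of_nonneg (Real.sqrt_nonneg _)).2 fun i => Real.abs_le_sqrt ?_
    fin_cases i
    · exact le_add_of_nonneg_right (sq_nonneg _)
    · exact le_add_of_nonneg_left (sq_nonneg _)
  exact (Real.le_sqrt (norm_nonneg v) (by positivity)).1 h

section Lewy

variable {u : (Fin 2 → ℝ) → ℝ}

theorem antilipschitzWith_lewyMap (hc : ConvexOn ℝ Set.univ u) (hd : Differentiable ℝ u) :
    AntilipschitzWith 1 (lewyMap u) := by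
  refine AntilipschitzWith.of_le_mul_dist fun z w => ?_
  have hmono := hc.fderiv_sub_fderiv_nonneg hd z w
  rw [ContinuousLinearMap.apply_fin_two] at hmono
  simp only [Pi.sub_apply, _root_.sub_apply, smul_eq_mul] at hmono
  rw [dist_eq_norm, dist_eq_norm, NNReal.coe_one, one_mul]
  refine le_of_sq_le_sq ?_ (norm_nonneg _)
  refine (norm_sq_le_sq_add_sq _).trans ?_
  rw [← Complex.normSq_eq_norm_sq, Complex.normSq_apply]
  simp [lewyMap]
  nlinarith [sq_nonneg (fderiv ℝ u z (Pi.single 0 1) - fderiv ℝ u w (Pi.single 0 1)),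
    sq_nonneg (fderiv ℝ u z (Pi.single 1 1) - fderiv ℝ u w (Pi.single 1 1))]

theorem surjective_lewyMap (hc : ConvexOn ℝ Set.univ u) (hd : Differentiable ℝ u) :
    Function.Surjective (lewyMap u) := by
  intro ζ
  let p₀ : (Fin 2 → ℝ) →L[ℝ] ℝ := ContinuousLinearMap.proj 0
  let p₁ : (Fin 2 → ℝ) →L[ℝ] ℝ := ContinuousLinearMap.proj 1
  let l : (Fin 2 → ℝ) →L[ℝ] ℝ := ζ.re • p₀ + ζ.im • p₁
  let f : (Fin 2 → ℝ) → ℝ := fun z => (1 / 2) * (z 0 ^ 2 + z 1 ^ 2) + u z - l z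
  have hf : Continuous f := by
    have := hd.continuous
    fun_prop
  obtain ⟨z, hz⟩ := hf.exists_forall_le' 0 (by
    filter_upwards [(tendsto_norm_cocompact_atTop (E := Fin 2 → ℝ)).eventually_ge_atTop
      (2 * ‖fderiv ℝ u 0 - l‖)] with x hx
    have h₁ := hc.add_fderiv_le hd 0 x
    have h₂ := (abs_le.1 ((fderiv ℝ u 0 - l).le_opNorm x)).1
    have h₃ := norm_sq_le_sq_add_sq x
    simp only [_root_.sub_apply, sub_zero] at h₁ h₂
    simp only [f, map_zero, Pi.zero_apply]
    nlinarith [norm_nonneg x])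
  have hder : HasFDerivAt f ((1 / 2 : ℝ) • ((2 * z 0) • p₀ + (2 * z 1) • p₁) +
      fderiv ℝ u z - l) z := by
    have h₀ : HasFDerivAt (fun z : Fin 2 → ℝ => z 0) p₀ z := p₀.hasFDerivAt
    have h₁ : HasFDerivAt (fun z : Fin 2 → ℝ => z 1) p₁ z := p₁.hasFDerivAt
    have h := ((((h₀.pow 2).add (h₁.pow 2)).const_mul (1 / 2)).add (hd z).hasFDerivAt).sub
      l.hasFDerivAt
    refine h.congr_fderiv ?_
    simp
  have hmin : IsLocalMin f z := .of_forall hz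
  have hzero := hmin.hasFDerivAt_eq_zero hder
  refine ⟨z, ?_⟩
  have e₀ := DFunLike.congr_fun hzero (Pi.single 0 1)
  have e₁ := DFunLike.congr_fun hzero (Pi.single 1 1)
  simp [l, p₀, p₁] at e₀ e₁
  apply Complex.ext <;> simp [lewyMap] <;> linarith

/-- The derivative of `lewyConj u` with respect to the coordinate `lewyMap u`. -/
noncomputable def lewyDeriv (r s t : ℝ) : ℂ :=
  ⟨(t - r) / (2 + r + t), 2 * s / (2 + r + t)⟩

theorem normSq_lewyDeriv {r s t : ℝ} (hdet : r * t - s * s = 1) (h : 0 < 2 + r + t) :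
    Complex.normSq (lewyDeriv r s t) = 1 - 4 / (2 + r + t) := by
  simp [lewyDeriv, Complex.normSq_apply]
  field_simp
  linear_combination -4 * hdet

theorem eq_of_lewyDeriv_eq {r s t r' s' t' : ℝ} (hdet : r * t - s * s = 1)
    (hdet' : r' * t' - s' * s' = 1) (h : 0 < 2 + r + t) (h' : 0 < 2 + r' + t')
    (heq : lewyDeriv r s t = lewyDeriv r' s' t') : r = r' ∧ s = s' ∧ t = t' := by
  have hn := normSq_lewyDeriv hdet h
  rw [heq, normSq_lewyDeriv hdet' h'] at hn
  have hD : 2 + r + t = 2 + r' + t' := by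
    field_simp at hn
    linarith
  have hre := congrArg Complex.re heq
  have him := congrArg Complex.im heq
  simp [lewyDeriv, hD, h'.ne'] at hre him
  refine ⟨?_, ?_, ?_⟩ <;> linarith

theorem hasFDerivAt_lewyConj_sub (hd₂ : Differentiable ℝ (fderiv ℝ u)) {z : Fin 2 → ℝ}
    {r s t : ℝ} (hr : fderiv ℝ (fderiv ℝ u) z (Pi.single 0 1) (Pi.single 0 1) = r)
    (hs : fderiv ℝ (fderiv ℝ u) z (Pi.single 0 1) (Pi.single 1 1) = s)
    (hs' : fderiv ℝ (fderiv ℝ u) z (Pi.single 1 1) (Pi.single 0 1) = s)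
    (ht : fderiv ℝ (fderiv ℝ u) z (Pi.single 1 1) (Pi.single 1 1) = t)
    (hdet : r * t - s * s = 1) (hpos : 0 < 2 + r + t) :
    HasFDerivAt (fun w => lewyConj u w - lewyDeriv r s t * lewyMap u w)
      (0 : (Fin 2 → ℝ) →L[ℝ] ℂ) z := by
  have hz (i : Fin 2) : HasFDerivAt (fun w : Fin 2 → ℝ => w i)
      (ContinuousLinearMap.proj i : (Fin 2 → ℝ) →L[ℝ] ℝ) z := hasFDerivAt_apply i z
  have hp (v : Fin 2 → ℝ) := (hd₂ z).hasFDerivAt.clm_apply (hasFDerivAt_const v z)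
  have hL := ((hz 0).add (hp (Pi.single 0 1))).ofReal_add_ofReal_mul_I
    ((hz 1).add (hp (Pi.single 1 1)))
  have hW := ((hz 0).sub (hp (Pi.single 0 1))).ofReal_add_ofReal_mul_I
    ((hz 1).sub (hp (Pi.single 1 1))).neg
  refine (hW.sub (hL.const_mul (lewyDeriv r s t))).congr_fderiv ?_
  apply ContinuousLinearMap.ext_fin_two <;> apply Complex.ext <;>
    simp [lewyDeriv, hr, hs, hs', ht] <;> field_simp <;> grind

end Lewy

/-- (Jörgens) An entire smooth convex solution of `det Hess u = 1` on `ℝ²`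
is a quadratic polynomial. -/
theorem jorgens_theorem (u : (Fin 2 → ℝ) → ℝ)
    (hsmooth : ContDiff ℝ (⊤ : ℕ∞) u)
    (hconv : ConvexOn ℝ Set.univ u)
    (hma : ∀ x, (Hess u x).det = 1) :
    ∃ (M : Matrix (Fin 2) (Fin 2) ℝ) (b : Fin 2 → ℝ) (c : ℝ),
      ∀ x, u x = (1 / 2) * (x ⬝ᵥ M.mulVec x) + b ⬝ᵥ x + c := by
  have hd : Differentiable ℝ u := hsmooth.differentiable (by simp)
  have hd₂ : Differentiable ℝ (fderiv ℝ u) :=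
    ((contDiff_infty.1 hsmooth 2).fderiv_right (m := 1) (by norm_num)).differentiable (by simp)
  set B := fderiv ℝ (fderiv ℝ u) with hB
  have hsymm (z v w) : B z v w = B z w v :=
    second_derivative_symmetric (fun y => (hd y).hasFDerivAt) (hd₂ z).hasFDerivAt v w
  have hdet (z) : B z (Pi.single 0 1) (Pi.single 0 1) * B z (Pi.single 1 1) (Pi.single 1 1) -
      B z (Pi.single 0 1) (Pi.single 1 1) * B z (Pi.single 0 1) (Pi.single 1 1) = 1 := by
    have h := hma z
    simp only [Matrix.det_fin_two, Hess, iteratedFDeriv_two_apply, Matrix.cons_val_zero,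
      Matrix.cons_val_one] at h
    rwa [← hB, hsymm z (Pi.single 1 1) (Pi.single 0 1)] at h
  have hpos (z) : 0 < 2 + B z (Pi.single 0 1) (Pi.single 0 1) +
      B z (Pi.single 1 1) (Pi.single 1 1) := by
    have h₀ := hconv.fderiv_fderiv_nonneg hd hd₂ z (Pi.single 0 1)
    have h₁ := hconv.fderiv_fderiv_nonneg hd hd₂ z (Pi.single 1 1)
    rw [← hB] at h₀ h₁
    linarith
  let k (z) := lewyDeriv (B z (Pi.single 0 1) (Pi.single 0 1))
    (B z (Pi.single 0 1) (Pi.single 1 1)) (B z (Pi.single 1 1) (Pi.single 1 1))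
  have hanti := antilipschitzWith_lewyMap hconv hd
  obtain ⟨g, hg⟩ := (surjective_lewyMap hconv hd).hasRightInverse
  have hF (ζ) : HasDerivAt (fun ξ => lewyConj u (g ξ)) (k (g ζ)) ζ :=
    hasDerivAt_comp_rightInverse hanti hg
      (hasFDerivAt_lewyConj_sub hd₂ rfl rfl (hsymm _ _ _) rfl (hdet _) (hpos _))
  have hk : Differentiable ℂ (fun ζ => k (g ζ)) := by
    have h := Differentiable.deriv (fun ζ => (hF ζ).differentiableAt)
    rwa [funext fun ζ => (hF ζ).deriv] at h
  have hbdd : Bornology.IsBounded (Set.range fun ζ => k (g ζ)) := by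
    refine (Metric.isBounded_closedBall (x := (0 : ℂ)) (r := 1)).subset ?_
    rintro _ ⟨ζ, rfl⟩
    have h := normSq_lewyDeriv (hdet (g ζ)) (hpos (g ζ))
    have h' := div_nonneg (zero_le_four (α := ℝ)) (hpos (g ζ)).le
    rw [Complex.normSq_eq_norm_sq] at h
    rw [mem_closedBall_zero_iff, ← sq_le_one_iff₀ (norm_nonneg _), h]
    linarith
  have hconst (z) : B z = B 0 := by
    have h := hk.apply_eq_apply_of_bounded hbdd (lewyMap u z) (lewyMap u 0)
    simp only [hanti.injective.eq_iff.1 (hg (lewyMap u _))] at h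
    obtain ⟨hr, hs, ht⟩ := eq_of_lewyDeriv_eq (hdet z) (hdet 0) (hpos z) (hpos 0) h
    refine ContinuousLinearMap.ext_fin_two (ContinuousLinearMap.ext_fin_two hr hs)
      (ContinuousLinearMap.ext_fin_two ?_ ht)
    rw [hsymm z, hsymm 0, hs]
  refine ⟨fun i j => B 0 (Pi.single i 1) (Pi.single j 1),
    fun i => fderiv ℝ u 0 (Pi.single i 1), u 0, fun x => ?_⟩
  rw [eq_quadratic_of_fderiv_fderiv_const hd hd₂ (hsymm 0) hconst x,
    (B 0).apply_fin_two x, (fderiv ℝ u 0).apply_fin_two x]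
  simp only [_root_.add_apply, _root_.smul_apply,
    ContinuousLinearMap.apply_fin_two _ x, dotProduct, Matrix.mulVec, Fin.sum_univ_two,
    smul_eq_mul]
  ring
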